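/- Let Θ, Γ : ℕ → (0,∞) be functions such that Θ(i) + Γ(i) < 1 for every i. Suppose C is a closed subset of (2^ℕ)^d such that □_{Θ,Γ}(C) holds, ℱ is a finite family of continuous functions from C to 2^ℕ, and μ > 0. Then there exist a ∈ C^1_μ and η : ℕ → (0,∞) such that □_{η,Γ}(⋂_{F∈ℱ} F^{−1}[a]) holds. -/

import Mathlib

open MeasureTheory Filter Set Topology
open scoped ENNReal

noncomputable section

/-- The Cantor space `2^ℕ`. -/
abbrev Cantor : Type := ℕ → Bool

/-- The uniform product ("fair coin-flipping") probability measure on `2^ℕ`, realized as the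
pushforward of Lebesgue measure on `[0,1)` under the binary-digit map. -/
noncomputable def cantorMeasure : Measure Cantor :=
  Measure.map (fun x : ℝ => fun n : ℕ => decide (⌊x * 2 ^ (n + 1)⌋ % 2 = 1))
    (volume.restrict (Set.Ico (0 : ℝ) 1))

/-- The basic cylinder `[a]` determined by a finite binary sequence `a`. -/
def cyl (a : List Bool) : Set Cantor := {x | ∀ i : Fin a.length, x i = a.get i}

/-- `[A] = ⋃ a ∈ A, [a]`. -/
def cylSet (A : Set (List Bool)) : Set Cantor := ⋃ a ∈ A, cyl a

/-- The weight `2^(-|a|·r)` of a node `a`. -/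
noncomputable def wt (r : ℝ) (a : List Bool) : ℝ≥0∞ := (2 : ℝ≥0∞) ^ (-(a.length : ℝ) * r)

/-- `Σ_{a ∈ A} 2^(-|a|·r)`. -/
noncomputable def wtSum (r : ℝ) (A : Set (List Bool)) : ℝ≥0∞ := ∑' a : A, wt r (a : List Bool)

/-- `A ∈ C^∞_ε`, i.e. `Σ_{a ∈ A} 2^(-|a|·r) ≤ ε`. -/
def memCinf (r ε : ℝ) (A : Set (List Bool)) : Prop := wtSum r A ≤ ENNReal.ofReal ε

/-- The `r`-dimensional dyadic Hausdorff capacity `λ^r_∞`. -/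
noncomputable def hcap (r : ℝ) (X : Set Cantor) : ℝ≥0∞ :=
  ⨅ (A : Set (List Bool)) (_ : X ⊆ cylSet A), wtSum r A

/-- `□_δ(X) = inf {λ^r_∞(X \ Z) : Z measurable, λ Z < δ}`. -/
noncomputable def sqcap (r δ : ℝ) (X : Set Cantor) : ℝ≥0∞ :=
  ⨅ (Z : Set Cantor) (_ : MeasurableSet Z) (_ : cantorMeasure Z < ENNReal.ofReal δ),
    hcap r (X \ Z)

/-- The relation `□_{Θ,Γ}(X)` for `X ⊆ (2^ℕ)^(d+1)` (the index `d` codes dimension `d+1`):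
for dimension `1` it says `□_{Θ 0}(X) ≥ Γ 0`, and for dimension `n+2` it says
`□_{Θ (n+1)}({x : □_{Θ,Γ}(X(x,·))}) ≥ Γ (n+1)`, slicing along the first coordinate. -/
def SqTG (r : ℝ) (Θ Γ : ℕ → ℝ) : (d : ℕ) → Set (Fin (d + 1) → Cantor) → Prop
  | 0, X => ENNReal.ofReal (Γ 0) ≤ sqcap r (Θ 0) {y : Cantor | (fun _ : Fin 1 => y) ∈ X}
  | (n + 1), X => ENNReal.ofReal (Γ (n + 1)) ≤
      sqcap r (Θ (n + 1))
        {x : Cantor | SqTG r Θ Γ n {y : Fin (n + 1) → Cantor | Fin.cons x y ∈ X}}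

/-- Expectation of `φ` at a random subset of `S` that contains each point independently with
probability `p`. -/
def expect {S : Type} [Fintype S] (p : ℝ) (φ : Finset S → ℝ) : ℝ :=
  ∑ R : Finset S, p ^ R.card * (1 - p) ^ (Fintype.card S - R.card) * φ R

/-- The indicator of `B ⊆ R`, normalized to have expectation one. -/
def normInd {S : Type} [DecidableEq S] (p : ℝ) (B R : Finset S) : ℝ :=
  p⁻¹ ^ B.card * if B ⊆ R then 1 else 0

lemma normInd_nonneg {S : Type} [DecidableEq S] {p : ℝ} (hp0 : 0 < p) (B R : Finset S) :
    0 ≤ normInd p B R := by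
  unfold normInd
  split_ifs <;> positivity

lemma normInd_le {S : Type} [DecidableEq S] {p : ℝ} (hp0 : 0 < p) (hp1 : p ≤ 1) {h : ℕ}
    {B : Finset S} (hB : B.card ≤ h) (R : Finset S) : normInd p B R ≤ p⁻¹ ^ h := by
  have h1 : p⁻¹ ^ B.card ≤ p⁻¹ ^ h := pow_le_pow_right₀ ((one_le_inv₀ hp0).2 hp1) hB
  have h2 : 0 < p⁻¹ ^ h := by positivity
  unfold normInd
  split_ifs <;> simp only [mul_one, mul_zero] <;> linarith

section Expect

variable {S : Type} [Fintype S] {p : ℝ}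

lemma expect_mono (hp0 : 0 ≤ p) (hp1 : p ≤ 1) {φ ψ : Finset S → ℝ} (h : ∀ R, φ R ≤ ψ R) :
    expect p φ ≤ expect p ψ := by
  have : 0 ≤ 1 - p := by linarith
  exact Finset.sum_le_sum fun R _ => mul_le_mul_of_nonneg_left (h R) (by positivity)

lemma expect_add (φ ψ : Finset S → ℝ) :
    expect p (fun R => φ R + ψ R) = expect p φ + expect p ψ := by
  simp only [expect, mul_add, Finset.sum_add_distrib]

lemma expect_const_mul (c : ℝ) (φ : Finset S → ℝ) :
    expect p (fun R => c * φ R) = c * expect p φ := by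
  simp only [expect, Finset.mul_sum]
  exact Finset.sum_congr rfl fun R _ => by ring

lemma expect_sum {ι : Type} (s : Finset ι) (φ : ι → Finset S → ℝ) :
    expect p (fun R => ∑ i ∈ s, φ i R) = ∑ i ∈ s, expect p (φ i) := by
  simp only [expect, Finset.mul_sum]
  exact Finset.sum_comm

lemma expect_const (c : ℝ) : expect p (fun _ : Finset S => c) = c := by
  have h := Fintype.sum_pow_mul_eq_add_pow S p (1 - p)
  rw [expect, ← Finset.sum_mul, h]
  simp

lemma expect_ite_mem [DecidableEq S] (s : S) (φ : Finset S → ℝ) :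
    expect p (fun R => if s ∈ R then φ R else 0) = p * expect p (fun R => φ (insert s R)) := by
  have hs : s ∉ Finset.univ.erase s := Finset.notMem_erase _ _
  have key : ∀ f : Finset S → ℝ, ∑ R, f R =
      ∑ R ∈ (Finset.univ.erase s).powerset, f R +
        ∑ R ∈ (Finset.univ.erase s).powerset, f (insert s R) := by
    intro f
    rw [← Finset.sum_powerset_insert hs, Finset.insert_erase (Finset.mem_univ s),
      Finset.powerset_univ]
  simp only [expect]
  rw [key, key, ← Finset.sum_add_distrib, ← Finset.sum_add_distrib, Finset.mul_sum]
  refine Finset.sum_congr rfl fun R hR => ?_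
  have hsR : s ∉ R := fun h => hs (Finset.mem_powerset.1 hR h)
  have hlt : R.card < Fintype.card S :=
    Finset.card_lt_univ_of_notMem hsR
  obtain ⟨q, hq⟩ : ∃ q, Fintype.card S = R.card + 1 + q := ⟨_, (Nat.add_sub_of_le hlt).symm⟩
  have e1 : Fintype.card S - R.card = q + 1 := by omega
  have e2 : Fintype.card S - (R.card + 1) = q := by omega
  simp only [hsR, if_false, Finset.mem_insert_self, if_true, Finset.card_insert_of_notMem hsR,
    Finset.insert_idem, e1, e2]
  ring

lemma expect_ite_subset [DecidableEq S] (A : Finset S) (φ : Finset S → ℝ) :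
    expect p (fun R => if A ⊆ R then φ R else 0)
      = p ^ A.card * expect p (fun R => φ (R ∪ A)) := by
  induction A using Finset.induction_on generalizing φ with
  | empty => simp
  | insert s A hs ih =>
    have h1 : (fun R : Finset S => if insert s A ⊆ R then φ R else 0)
        = fun R => if s ∈ R then (if A ⊆ R then φ R else 0) else 0 := by
      ext R
      by_cases h : s ∈ R <;> simp [Finset.insert_subset_iff, h]
    have h2 : (fun R : Finset S => if A ⊆ insert s R then φ (insert s R) else 0)
        = fun R => if A ⊆ R then φ (insert s R) else 0 := by
      ext R
      simp only [Finset.subset_insert_iff_of_notMem hs]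
    rw [h1, expect_ite_mem, h2, ih fun R => φ (insert s R), Finset.card_insert_of_notMem hs]
    simp only [Finset.union_insert]
    ring

lemma expect_normInd_mul [DecidableEq S] (hp0 : 0 < p) (B : Finset S) (φ : Finset S → ℝ) :
    expect p (fun R => normInd p B R * φ R) = expect p (fun R => φ (R ∪ B)) := by
  have h : (fun R => normInd p B R * φ R)
      = fun R => p⁻¹ ^ B.card * if B ⊆ R then φ R else 0 := by
    ext R
    unfold normInd
    split_ifs <;> simp
  rw [h, expect_const_mul, expect_ite_subset, ← mul_assoc, ← mul_pow, inv_mul_cancel₀ hp0.ne',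
    one_pow, one_mul]

lemma expect_normInd [DecidableEq S] (hp0 : 0 < p) (B : Finset S) :
    expect p (normInd p B) = 1 := by
  have := expect_normInd_mul hp0 B fun _ => 1
  simpa [expect_const] using this

lemma expect_normInd_mul_normInd_le [DecidableEq S] (hp0 : 0 < p) (hp1 : p ≤ 1) {h : ℕ}
    {B B' : Finset S} (hB' : B'.card ≤ h) :
    expect p (fun R => normInd p B R * normInd p B' R)
      ≤ 1 + if Disjoint B B' then 0 else p⁻¹ ^ h := by
  rw [expect_normInd_mul hp0]
  split_ifs with hd
  · have : (fun R => normInd p B' (R ∪ B)) = normInd p B' := by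
      ext R
      have : B' ⊆ R ∪ B ↔ B' ⊆ R :=
        ⟨fun hs => hd.symm.left_le_of_le_sup_right hs,
          fun hs => hs.trans Finset.subset_union_left⟩
      simp only [normInd, this]
    rw [this, expect_normInd hp0, add_zero]
  · refine (expect_mono hp0.le hp1 fun R => normInd_le hp0 hp1 hB' (R ∪ B)).trans ?_
    rw [expect_const]
    linarith

lemma expect_sq_sum_normInd_le [DecidableEq S] {T : Type} [Fintype T] (hp0 : 0 < p) (hp1 : p ≤ 1)
    {h : ℕ} {δ : ℝ} (hδ : 0 ≤ δ) {v w : T → ℝ} (hv : ∀ t, 0 ≤ v t) (hvw : ∀ t, v t ≤ w t)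
    (hw : ∑ t, w t ≤ 1) {B : T → Finset S} (hB : ∀ t, (B t).card ≤ h)
    (hlight : ∀ t, ∀ s ∈ B t, (∑ u, if s ∈ B u then w u else 0) ≤ δ) :
    expect p (fun R => (∑ t, v t * normInd p (B t) R - ∑ t, v t) ^ 2) ≤ p⁻¹ ^ h * (h * δ) := by
  have hw0 : ∀ t, 0 ≤ w t := fun t => (hv t).trans (hvw t)
  have hpos : 0 ≤ p⁻¹ ^ h := by positivity
  have hcov : ∀ t u, expect p (fun R => (normInd p (B t) R - 1) * (normInd p (B u) R - 1))
      ≤ if Disjoint (B t) (B u) then 0 else p⁻¹ ^ h := by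
    intro t u
    have e : (fun R => (normInd p (B t) R - 1) * (normInd p (B u) R - 1)) = fun R =>
        normInd p (B t) R * normInd p (B u) R
          + ((-1) * normInd p (B t) R + ((-1) * normInd p (B u) R + 1)) := by
      ext R; ring
    rw [e, expect_add, expect_add, expect_add, expect_const_mul, expect_const_mul, expect_const,
      expect_normInd hp0, expect_normInd hp0]
    have := expect_normInd_mul_normInd_le hp0 hp1 (B := B t) (hB u)
    linarith
  have hex : (fun R => (∑ t, v t * normInd p (B t) R - ∑ t, v t) ^ 2) = fun R =>
      ∑ t, ∑ u, v t * v u * ((normInd p (B t) R - 1) * (normInd p (B u) R - 1)) := by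
    ext R
    rw [← Finset.sum_sub_distrib, sq, Finset.sum_mul_sum]
    exact Finset.sum_congr rfl fun t _ => Finset.sum_congr rfl fun u _ => by ring
  rw [hex, expect_sum]
  simp only [expect_sum, expect_const_mul]
  have hrow : ∀ t, ∑ u, w u * (if Disjoint (B t) (B u) then 0 else p⁻¹ ^ h)
      ≤ p⁻¹ ^ h * (h * δ) := by
    intro t
    calc ∑ u, w u * (if Disjoint (B t) (B u) then 0 else p⁻¹ ^ h)
        ≤ ∑ u, ∑ s ∈ B t, p⁻¹ ^ h * (if s ∈ B u then w u else 0) := by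
          refine Finset.sum_le_sum fun u _ => ?_
          have hnn : ∀ s ∈ B t, 0 ≤ p⁻¹ ^ h * (if s ∈ B u then w u else 0) := fun s _ =>
            mul_nonneg hpos (by split_ifs <;> [exact hw0 u; exact le_rfl])
          split_ifs with hd
          · rw [mul_zero]
            exact Finset.sum_nonneg hnn
          · obtain ⟨s, hs, hs'⟩ := Finset.not_disjoint_iff.1 hd
            refine le_trans ?_ (Finset.single_le_sum hnn hs)
            rw [if_pos hs', mul_comm]
      _ = ∑ s ∈ B t, p⁻¹ ^ h * ∑ u, (if s ∈ B u then w u else 0) := by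
          rw [Finset.sum_comm]
          simp only [Finset.mul_sum]
      _ ≤ ∑ s ∈ B t, p⁻¹ ^ h * δ :=
          Finset.sum_le_sum fun s hs => mul_le_mul_of_nonneg_left (hlight t s hs) hpos
      _ ≤ p⁻¹ ^ h * (h * δ) := by
          rw [Finset.sum_const, nsmul_eq_mul]
          have : ((B t).card : ℝ) ≤ h := by exact_mod_cast hB t
          nlinarith [mul_le_mul_of_nonneg_right this (mul_nonneg hpos hδ)]
  calc ∑ t, ∑ u, v t * v u * expect p
          (fun R => (normInd p (B t) R - 1) * (normInd p (B u) R - 1))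
      ≤ ∑ t, ∑ u, w t * (w u * (if Disjoint (B t) (B u) then 0 else p⁻¹ ^ h)) := by
        refine Finset.sum_le_sum fun t _ => Finset.sum_le_sum fun u _ => ?_
        rw [← mul_assoc]
        have h0 : (0 : ℝ) ≤ if Disjoint (B t) (B u) then 0 else p⁻¹ ^ h := by
          split_ifs <;> [exact le_rfl; exact hpos]
        exact (mul_le_mul_of_nonneg_left (hcov t u) (mul_nonneg (hv t) (hv u))).trans
          (mul_le_mul_of_nonneg_right
            (mul_le_mul (hvw t) (hvw u) (hv u) (hw0 t)) h0)
    _ ≤ ∑ t, w t * (p⁻¹ ^ h * (h * δ)) := by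
        refine Finset.sum_le_sum fun t _ => ?_
        rw [← Finset.mul_sum]
        exact mul_le_mul_of_nonneg_left (hrow t) (hw0 t)
    _ ≤ p⁻¹ ^ h * (h * δ) := by
        rw [← Finset.sum_mul]
        exact mul_le_of_le_one_left (by positivity) hw

open Classical in
/-- Random sampling with heavy points added: if each of finitely many weighted upward closed events
`E t` holds with high probability once a small set `H t` is added to the random set, then after
adding one small set `H'`, with high probability a fixed proportion of the events holds
simultaneously with respect to each of finitely many weightings. -/
lemma exists_heavy_set {ι T : Type} [Fintype ι] [Fintype T] (hp0 : 0 < p) (hp1 : p ≤ 1)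
    {h : ℕ} {θ ε δ : ℝ} (hθ : 0 < θ) (hδ : 0 < δ)
    (hδε : Fintype.card ι * (4 / θ ^ 2 * (p⁻¹ ^ h * (h * δ))) ≤ ε / 2)
    {w : T → ℝ} (hw1 : ∑ t, w t ≤ 1) {v : ι → T → ℝ} (hw0 : ∀ t, 0 ≤ w t)
    (hv0 : ∀ i t, 0 ≤ v i t)
    (hvw : ∀ i t, v i t ≤ w t) (hvθ : ∀ i, θ ≤ ∑ t, v i t) {H : T → Finset S}
    (hH : ∀ t, (H t).card ≤ h) {E : T → Finset S → Prop} (hEmono : ∀ t, Monotone (E t))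
    (hE : ∀ t, expect p (fun R => if E t (R ∪ H t) then 0 else 1) ≤ ε * θ / 8) :
    ∃ H' : Finset S, (H'.card : ℝ) ≤ h / δ ∧
      expect p (fun R => if ∀ i, p ^ h * θ / 4 ≤ ∑ t, (if E t (R ∪ H') then v i t else 0)
        then 0 else 1) ≤ ε := by
  set H' : Finset S := Finset.univ.filter fun s => δ ≤ ∑ t, if s ∈ H t then w t else 0
  set B : T → Finset S := fun t => H t \ H' with hBdef
  have hBcard : ∀ t, (B t).card ≤ h := fun t =>
    (Finset.card_le_card Finset.sdiff_subset).trans (hH t)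
  refine ⟨H', ?_, ?_⟩
  · rw [le_div_iff₀ hδ]
    calc (H'.card : ℝ) * δ = ∑ s ∈ H', δ := by rw [Finset.sum_const, nsmul_eq_mul]
      _ ≤ ∑ s ∈ H', ∑ t, (if s ∈ H t then w t else 0) :=
        Finset.sum_le_sum fun s hs => (Finset.mem_filter.1 hs).2
      _ ≤ ∑ s, ∑ t, (if s ∈ H t then w t else 0) :=
        Finset.sum_le_univ_sum_of_nonneg fun s => Finset.sum_nonneg fun t _ => by
          split_ifs <;> [exact hw0 t; exact le_rfl]
      _ = ∑ t, (H t).card * w t := by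
        rw [Finset.sum_comm]
        refine Finset.sum_congr rfl fun t _ => ?_
        rw [← Finset.sum_filter, Finset.sum_const, nsmul_eq_mul, Finset.filter_univ_mem]
      _ ≤ ∑ t, h * w t := Finset.sum_le_sum fun t _ =>
        mul_le_mul_of_nonneg_right (by exact_mod_cast hH t) (hw0 t)
      _ ≤ h := by
        rw [← Finset.mul_sum]
        exact mul_le_of_le_one_right (by positivity) hw1
  set g : ι → Finset S → ℝ := fun i R =>
    (∑ t, v i t * normInd p (B t) R - ∑ t, v i t) ^ 2 with hg
  set b : Finset S → ℝ := fun R =>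
    ∑ t, w t * (normInd p (B t) R * if E t (R ∪ H') then 0 else 1) with hb
  have hg_le : ∀ i, expect p (g i) ≤ p⁻¹ ^ h * (h * δ) := by
    intro i
    refine expect_sq_sum_normInd_le hp0 hp1 hδ.le (hv0 i) (hvw i) hw1 hBcard ?_
    intro t s hs
    have hs' : s ∉ H' := (Finset.mem_sdiff.1 hs).2
    have hlt : (∑ t, if s ∈ H t then w t else 0) < δ := by
      by_contra hcon
      exact hs' (Finset.mem_filter.2 ⟨Finset.mem_univ s, not_lt.1 hcon⟩)
    refine le_trans (Finset.sum_le_sum fun u _ => ?_) hlt.le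
    by_cases hu : s ∈ H u
    · simp only [hBdef, Finset.mem_sdiff, hu, hs', not_false_eq_true, and_self, if_true, le_refl]
    · simp [hBdef, hu]
  have hb_le : expect p b ≤ ε * θ / 8 := by
    have hεθ : ∀ t, expect p (fun R => normInd p (B t) R * if E t (R ∪ H') then 0 else 1)
        ≤ ε * θ / 8 := by
      intro t
      rw [expect_normInd_mul hp0]
      refine le_trans (expect_mono hp0.le hp1 fun R => ?_) (hE t)
      have hsub : R ∪ H t ≤ R ∪ B t ∪ H' := by
        intro s hs
        simp only [hBdef, Finset.mem_union, Finset.mem_sdiff] at hs ⊢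
        tauto
      split_ifs with h1 h2 h2
      · exact le_rfl
      · exact zero_le_one
      · exact absurd (hEmono t hsub h2) h1
      · exact le_rfl
    simp only [hb, expect_sum, expect_const_mul]
    by_cases hne : Nonempty T
    · obtain ⟨t₀⟩ := hne
      have h0 : 0 ≤ ε * θ / 8 := by
        refine (expect_const (S := S) (p := p) 0).ge.trans (le_trans ?_ (hE t₀))
        refine expect_mono hp0.le hp1 fun R => ?_
        split_ifs <;> norm_num
      calc _ ≤ ∑ t, w t * (ε * θ / 8) :=
            Finset.sum_le_sum fun t _ => mul_le_mul_of_nonneg_left (hεθ t) (hw0 t)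
        _ ≤ ε * θ / 8 := by
            rw [← Finset.sum_mul]
            exact mul_le_of_le_one_left h0 hw1
    · have : IsEmpty T := not_nonempty_iff.1 hne
      have h0 : 0 ≤ ε / 2 := le_trans (by positivity) hδε
      simp only [Finset.univ_eq_empty, Finset.sum_empty]
      have : 0 ≤ ε := by linarith
      positivity
  have hpt : ∀ R, (if ∀ i, p ^ h * θ / 4 ≤ ∑ t, (if E t (R ∪ H') then v i t else 0)
      then (0 : ℝ) else 1) ≤ (∑ i, 4 / θ ^ 2 * g i R) + 4 / θ * b R := by
    intro R
    have hgn : ∀ i ∈ Finset.univ, 0 ≤ 4 / θ ^ 2 * g i R := fun i _ => by positivity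
    have hbn : 0 ≤ b R := Finset.sum_nonneg fun t _ => mul_nonneg (hw0 t)
      (mul_nonneg (normInd_nonneg hp0 _ _) (by split_ifs <;> norm_num))
    have hbn' : 0 ≤ 4 / θ * b R := by positivity
    split_ifs with hall
    · exact add_nonneg (Finset.sum_nonneg hgn) hbn'
    push Not at hall
    obtain ⟨i, hi⟩ := hall
    have hsplit : ∑ t, v i t * normInd p (B t) R
        ≤ p⁻¹ ^ h * (∑ t, (if E t (R ∪ H') then v i t else 0)) + b R := by
      rw [Finset.mul_sum, ← Finset.sum_add_distrib]
      refine Finset.sum_le_sum fun t _ => ?_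
      have h1 := normInd_le hp0 hp1 (hBcard t) R
      have h2 := normInd_nonneg hp0 (B t) R
      split_ifs
      · have := mul_le_mul_of_nonneg_left h1 (hv0 i t)
        linarith
      · have := mul_le_mul_of_nonneg_right (hvw i t) h2
        linarith
    have hsmall : p⁻¹ ^ h * (∑ t, (if E t (R ∪ H') then v i t else 0)) ≤ θ / 4 := by
      have hpp : p⁻¹ ^ h * p ^ h = 1 := by rw [← mul_pow, inv_mul_cancel₀ hp0.ne', one_pow]
      calc _ ≤ p⁻¹ ^ h * (p ^ h * θ / 4) := mul_le_mul_of_nonneg_left hi.le (by positivity)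
        _ = (p⁻¹ ^ h * p ^ h) * (θ / 4) := by ring
        _ = θ / 4 := by rw [hpp, one_mul]
    rcases le_or_gt (θ / 4) (b R) with hbig | hbig
    · have : 1 ≤ 4 / θ * b R := by
        calc (1 : ℝ) = 4 / θ * (θ / 4) := by field_simp
          _ ≤ _ := mul_le_mul_of_nonneg_left hbig (by positivity)
      have := Finset.sum_nonneg hgn
      linarith
    · have hdev : θ / 2 ≤ ∑ t, v i t - ∑ t, v i t * normInd p (B t) R := by
        have := hvθ i
        linarith
      have hgi : (θ / 2) ^ 2 ≤ g i R := by
        simp only [hg]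
        nlinarith
      have : 1 ≤ 4 / θ ^ 2 * g i R := by
        calc (1 : ℝ) = 4 / θ ^ 2 * (θ / 2) ^ 2 := by field_simp; norm_num
          _ ≤ _ := mul_le_mul_of_nonneg_left hgi (by positivity)
      have := Finset.single_le_sum hgn (Finset.mem_univ i)
      linarith
  refine (expect_mono hp0.le hp1 hpt).trans ?_
  rw [expect_add, expect_sum, expect_const_mul]
  simp only [expect_const_mul]
  have h1 : ∑ i, 4 / θ ^ 2 * expect p (g i) ≤ ε / 2 := by
    refine le_trans (Finset.sum_le_sum fun i _ =>
      mul_le_mul_of_nonneg_left (hg_le i) (by positivity)) ?_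
    rw [Finset.sum_const, nsmul_eq_mul]
    exact hδε
  have h2 : 4 / θ * expect p b ≤ ε / 2 := by
    calc 4 / θ * expect p b ≤ 4 / θ * (ε * θ / 8) :=
          mul_le_mul_of_nonneg_left hb_le (by positivity)
      _ = ε / 2 := by field_simp; ring
  linarith

end Expect

section CantorMeasure

lemma measurable_binaryDigits :
    Measurable fun x : ℝ => fun n : ℕ => decide (⌊x * 2 ^ (n + 1)⌋ % 2 = 1) := by
  refine measurable_pi_lambda _ fun n => ?_
  have h : Measurable fun z : ℤ => decide (z % 2 = 1) := measurable_from_top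
  exact h.comp (Int.measurable_floor.comp (measurable_id.mul_const _))

instance : IsProbabilityMeasure cantorMeasure := by
  have : IsProbabilityMeasure (volume.restrict (Set.Ico (0 : ℝ) 1)) := ⟨by simp⟩
  exact Measure.isProbabilityMeasure_map measurable_binaryDigits.aemeasurable

lemma measurableSet_cyl (a : List Bool) : MeasurableSet (cyl a) := by
  have : cyl a = ⋂ i : Fin a.length, (fun x : Cantor => x i) ⁻¹' {a.get i} := by
    ext x
    simp [cyl]
  rw [this]
  exact MeasurableSet.iInter fun i => measurable_pi_apply _ (MeasurableSet.singleton _)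

lemma measurableSet_cylSet (A : Set (List Bool)) : MeasurableSet (cylSet A) :=
  MeasurableSet.biUnion A.to_countable fun a _ => measurableSet_cyl a

lemma cylSet_union (A B : Set (List Bool)) : cylSet (A ∪ B) = cylSet A ∪ cylSet B :=
  Set.biUnion_union A B cyl

lemma floor_mul_two (z : ℝ) : ⌊z * 2⌋ = 2 * ⌊z⌋ + ⌊z * 2⌋ % 2 := by
  have h : ⌊z * 2⌋ / 2 = ⌊z⌋ := by
    have := Int.floor_div_natCast (z * 2) 2
    simpa using this.symm
  omega

lemma floor_mul_two_pow_eq {x y : ℝ} (hxy : ⌊x⌋ = ⌊y⌋) (k : ℕ)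
    (h : ∀ i < k, (⌊x * 2 ^ (i + 1)⌋ % 2 = 1 ↔ ⌊y * 2 ^ (i + 1)⌋ % 2 = 1)) :
    ⌊x * 2 ^ k⌋ = ⌊y * 2 ^ k⌋ := by
  induction k with
  | zero => simpa using hxy
  | succ k ih =>
    have h1 := ih fun i hi => h i (hi.trans k.lt_succ_self)
    have h2 := h k k.lt_succ_self
    have hx := floor_mul_two (x * 2 ^ k)
    have hy := floor_mul_two (y * 2 ^ k)
    simp only [mul_assoc, ← pow_succ] at hx hy
    omega

lemma cantorMeasure_cyl_le (a : List Bool) :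
    cantorMeasure (cyl a) ≤ (2 : ℝ≥0∞) ^ (-(a.length : ℝ)) := by
  rw [cantorMeasure, Measure.map_apply measurable_binaryDigits (measurableSet_cyl a),
    Measure.restrict_apply (measurable_binaryDigits (measurableSet_cyl a))]
  rcases Set.eq_empty_or_nonempty ((fun x : ℝ => fun n : ℕ =>
    decide (⌊x * 2 ^ (n + 1)⌋ % 2 = 1)) ⁻¹' cyl a ∩ Set.Ico (0 : ℝ) 1) with he | ⟨x, hx, hx1⟩
  · rw [he]
    simp
  have hpos : (0 : ℝ) < 2 ^ a.length := by positivity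
  have hsub : (fun x : ℝ => fun n : ℕ => decide (⌊x * 2 ^ (n + 1)⌋ % 2 = 1)) ⁻¹' cyl a
      ∩ Set.Ico (0 : ℝ) 1 ⊆ Set.Ico ((⌊x * 2 ^ a.length⌋ : ℝ) / 2 ^ a.length)
        ((⌊x * 2 ^ a.length⌋ + 1 : ℝ) / 2 ^ a.length) := by
    rintro y ⟨hy, hy1⟩
    have hfl : ⌊x⌋ = ⌊y⌋ := by
      rw [Int.floor_eq_zero_iff.2 hx1, Int.floor_eq_zero_iff.2 hy1]
    have := floor_mul_two_pow_eq hfl a.length fun i hi => by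
      have e1 := hx ⟨i, hi⟩
      have e2 := hy ⟨i, hi⟩
      have := e1.trans e2.symm
      simpa using this
    rw [this, Set.mem_Ico, div_le_iff₀ hpos, lt_div_iff₀ hpos]
    exact ⟨Int.floor_le _, Int.lt_floor_add_one _⟩
  refine (measure_mono hsub).trans ?_
  rw [Real.volume_Ico, ← sub_div, add_sub_cancel_left, ENNReal.ofReal_div_of_pos hpos,
    ENNReal.rpow_neg, ENNReal.rpow_natCast, ENNReal.ofReal_pow (by norm_num)]
  simp

lemma cantorMeasure_cylSet_le {r : ℝ} (hr1 : r < 1) (m : ℕ) {A : Set (List Bool)}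
    (hA : ∀ a ∈ A, m ≤ a.length) :
    cantorMeasure (cylSet A) ≤ (2 : ℝ≥0∞) ^ (-(m : ℝ) * (1 - r)) * wtSum r A := by
  refine (measure_biUnion_le cantorMeasure A.to_countable cyl).trans ?_
  rw [wtSum, ← ENNReal.tsum_mul_left]
  refine ENNReal.tsum_le_tsum fun a => (cantorMeasure_cyl_le a).trans ?_
  rw [wt, ← ENNReal.rpow_add _ _ two_ne_zero ENNReal.ofNat_ne_top]
  refine ENNReal.rpow_le_rpow_of_exponent_le (by norm_num) ?_
  have : (m : ℝ) ≤ (a : List Bool).length := by exact_mod_cast hA a a.2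
  nlinarith

lemma wtSum_mono (r : ℝ) {A B : Set (List Bool)} (h : A ⊆ B) : wtSum r A ≤ wtSum r B :=
  ENNReal.tsum_mono_subtype (wt r) h

lemma hcap_mono (r : ℝ) {X Y : Set Cantor} (h : X ⊆ Y) : hcap r X ≤ hcap r Y :=
  le_iInf₂ fun A hA => iInf₂_le A (h.trans hA)

lemma sqcap_mono (r δ : ℝ) {X Y : Set Cantor} (h : X ⊆ Y) : sqcap r δ X ≤ sqcap r δ Y :=
  le_iInf fun Z => le_iInf₂ fun hZ hZδ =>
    (iInf_le _ Z).trans <| (iInf₂_le hZ hZδ).trans (hcap_mono r (Set.sdiff_subset_sdiff_left h))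

lemma le_sqcap_iff {r δ : ℝ} {c : ℝ≥0∞} {X : Set Cantor} :
    c ≤ sqcap r δ X ↔
      ∀ A, wtSum r A < c → ENNReal.ofReal δ ≤ cantorMeasure (X \ cylSet A) := by
  constructor
  · intro h A hA
    by_contra! hcon
    refine (h.trans ?_).not_gt hA
    refine (iInf_le _ (toMeasurable cantorMeasure (X \ cylSet A))).trans <|
      (iInf₂_le (measurableSet_toMeasurable _ _) (by rwa [measure_toMeasurable])).trans <|
      iInf₂_le A ?_
    intro x hx
    by_contra hxA
    exact hx.2 (subset_toMeasurable _ _ ⟨hx.1, hxA⟩)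
  · intro h
    refine le_iInf fun Z => le_iInf₂ fun _ hZδ => le_iInf₂ fun A hA => ?_
    by_contra! hcon
    refine ((h A hcon).trans (measure_mono ?_)).not_gt hZδ
    intro x hx
    by_contra hxZ
    exact hx.2 (hA ⟨hx.1, hxZ⟩)

lemma SqTG_mono (r : ℝ) (Θ Γ : ℕ → ℝ) (d : ℕ) : Monotone (SqTG r Θ Γ d) := by
  induction d with
  | zero => exact fun X Y h hX => le_trans hX (sqcap_mono _ _ fun y hy => h hy)
  | succ d ih =>
    exact fun X Y h hX => le_trans hX (sqcap_mono _ _ fun x hx => ih (fun y hy => h hy) hx)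

lemma SqTG_congr {r : ℝ} {Θ Θ' Γ : ℕ → ℝ} {d : ℕ} (h : ∀ i ≤ d, Θ i = Θ' i) :
    SqTG r Θ Γ d = SqTG r Θ' Γ d := by
  induction d with
  | zero => ext X; simp only [SqTG, h 0 le_rfl]
  | succ d ih =>
    ext X
    simp only [SqTG, h (d + 1) le_rfl, ih fun i hi => h i (hi.trans d.le_succ)]

end CantorMeasure

open Classical in
/-- The measurable hulls of finitely many sets can be disjointed into measurable sets whose measures
bound the outer measures of the original sets from below. -/
lemma exists_disjoint_weights {α T : Type} [MeasurableSpace α] [Fintype T] (μ : Measure α)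
    [IsProbabilityMeasure μ] (A : T → Set α) :
    ∃ M : T → Set α, ∑ t, μ.real (M t) ≤ 1 ∧ ∀ K, MeasurableSet K →
      μ.real ((⋃ t, A t) ∩ K) ≤ ∑ t, μ.real (M t ∩ K) ∧
      ∀ U : T → Prop, (∑ t, if U t then μ.real (M t ∩ K) else 0)
        ≤ μ.real ((⋃ t, ⋃ _ : U t, A t) ∩ K) := by
  let e := Fintype.equivFin T
  let N : T → Set α := fun t => toMeasurable μ (A t)
  have hN : ∀ t, MeasurableSet (N t) := fun t => measurableSet_toMeasurable _ _
  let M : T → Set α := fun t => N t \ ⋃ s, ⋃ _ : e s < e t, N s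
  have hM : ∀ t, MeasurableSet (M t) := fun t =>
    (hN t).diff (MeasurableSet.iUnion fun s => MeasurableSet.iUnion fun _ => hN s)
  have hdisj : Pairwise (Function.onFun Disjoint M) := by
    intro s t hst
    refine Set.disjoint_left.2 fun x hs ht => ?_
    rcases lt_or_gt_of_ne (e.injective.ne hst) with h | h
    · exact ht.2 (Set.mem_iUnion₂.2 ⟨s, h, hs.1⟩)
    · exact hs.2 (Set.mem_iUnion₂.2 ⟨t, h, ht.1⟩)
  have hsum : ∀ (s : Finset T) (K : Set α), MeasurableSet K →
      ∑ t ∈ s, μ.real (M t ∩ K) = μ.real (⋃ t ∈ s, M t ∩ K) := fun s K hK =>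
    (measureReal_biUnion_finset (fun a _ b _ hab =>
      (hdisj hab).mono Set.inter_subset_left Set.inter_subset_left)
      fun t _ => (hM t).inter hK).symm
  refine ⟨M, ?_, fun K hK => ⟨?_, fun U => ?_⟩⟩
  · have := hsum Finset.univ Set.univ MeasurableSet.univ
    simp only [Set.inter_univ] at this
    rw [this]
    exact measureReal_le_one
  · rw [hsum _ _ hK]
    refine measureReal_mono (fun x ⟨hx, hxK⟩ => ?_) (measure_ne_top _ _)
    obtain ⟨t, ht⟩ := Set.mem_iUnion.1 hx
    have hne : (Finset.univ.filter fun t => x ∈ N t).Nonempty :=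
      ⟨t, Finset.mem_filter.2 ⟨Finset.mem_univ _, subset_toMeasurable _ _ ht⟩⟩
    obtain ⟨t₀, ht₀, hmin⟩ := Finset.exists_min_image _ e hne
    refine Set.mem_iUnion₂.2 ⟨t₀, Finset.mem_univ _, ⟨(Finset.mem_filter.1 ht₀).2, ?_⟩, hxK⟩
    intro hmem
    obtain ⟨s, hs, hxs⟩ := Set.mem_iUnion₂.1 hmem
    exact (hmin s (Finset.mem_filter.2 ⟨Finset.mem_univ _, hxs⟩)).not_gt hs
  · rw [← Finset.sum_filter, hsum _ _ hK]
    set D := ⋃ t, ⋃ _ : U t, A t with hD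
    have hnull : μ (⋃ t ∈ Finset.univ.filter U, N t \ toMeasurable μ D) = 0 := by
      refine (measure_biUnion_null_iff (Finset.countable_toSet _)).2 fun t ht => ?_
      rw [Set.sdiff_eq, Measure.measure_toMeasurable_inter (measurableSet_toMeasurable _ _).compl
        (measure_ne_top _ _)]
      refine measure_mono_null (fun x hx => hx.2 (subset_toMeasurable _ _ ?_)) measure_empty
      exact Set.mem_iUnion₂.2 ⟨t, (Finset.mem_filter.1 ht).2, hx.1⟩
    rw [Measure.real, Measure.real, ← Measure.measure_toMeasurable_inter hK (measure_ne_top μ D)]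
    refine ENNReal.toReal_mono (measure_ne_top _ _) ?_
    refine (measure_mono (t := (toMeasurable μ D ∩ K) ∪
      ⋃ t ∈ Finset.univ.filter U, N t \ toMeasurable μ D) ?_).trans
      ((measure_union_le _ _).trans (by rw [hnull, add_zero]))
    intro x hx
    obtain ⟨t, ht, hxM, hxK⟩ := Set.mem_iUnion₂.1 hx
    by_cases hxD : x ∈ toMeasurable μ D
    · exact Or.inl ⟨hxD, hxK⟩
    · exact Or.inr (Set.mem_iUnion₂.2 ⟨t, ht, hxM.1, hxD⟩)

open Classical in
/-- If along every point `x` of a set `G` of large capacity the event `E x` has high probability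
once the small set `H x` is added to the random set, then after adding one small set `H'` the points
of `G` where the event holds have, with high probability, capacity at least as large. -/
lemma exists_le_sqcap {r p θ γ ε : ℝ} (hr1 : r < 1) (hp0 : 0 < p) (hp1 : p ≤ 1) (hθ : 0 < θ)
    (hε : 0 < ε) (h : ℕ) :
    ∃ h' : ℕ, ∃ η > 0, ∀ (S : Type) [Fintype S] (G : Set Cantor) (H : Cantor → Finset S)
      (E : Cantor → Finset S → Prop), (∀ x, Monotone (E x)) → (∀ x ∈ G, (H x).card ≤ h) →
      (∀ x ∈ G, expect p (fun R => if E x (R ∪ H x) then 0 else 1) ≤ ε * θ / 8) →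
      ENNReal.ofReal γ ≤ sqcap r θ G →
      ∃ H' : Finset S, H'.card ≤ h' ∧
        expect p (fun R => if ENNReal.ofReal γ ≤ sqcap r η {x | x ∈ G ∧ E x (R ∪ H')}
          then 0 else 1) ≤ ε := by
  set c := p ^ h * θ / 4
  have hc0 : 0 < c := by positivity
  obtain ⟨m, hm⟩ : ∃ m : ℕ,
      (2 : ℝ≥0∞) ^ (-(m : ℝ) * (1 - r)) * ENNReal.ofReal γ ≤ ENNReal.ofReal (c / 2) := by
    have hlim : Tendsto (fun m : ℕ => ENNReal.ofReal (((2 : ℝ) ^ (-(1 - r))) ^ m * γ)) atTop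
        (𝓝 (ENNReal.ofReal (0 * γ))) :=
      ENNReal.tendsto_ofReal ((tendsto_pow_atTop_nhds_zero_of_lt_one (by positivity)
        (Real.rpow_lt_one_of_one_lt_of_neg one_lt_two (by linarith))).mul_const γ)
    rw [zero_mul, ENNReal.ofReal_zero] at hlim
    obtain ⟨m, hm⟩ := (hlim.eventually_lt_const
      (ENNReal.ofReal_pos.2 (by positivity : 0 < c / 2))).exists
    refine ⟨m, le_trans (le_of_eq ?_) hm.le⟩
    rw [ENNReal.ofReal_mul (by positivity), ← Real.rpow_natCast, ← Real.rpow_mul (by norm_num),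
      ← ENNReal.ofReal_rpow_of_pos (by norm_num), ENNReal.ofReal_ofNat]
    congr 2
    ring
  let ι := {A : Set (List Bool) // A ⊆ {a | a.length < m} ∧ wtSum r A < ENNReal.ofReal γ}
  have hfin : Finite ι :=
    ((List.finite_length_lt Bool m).finite_subsets.subset fun A hA => hA.1).to_subtype
  have : Fintype ι := Fintype.ofFinite ι
  obtain ⟨δ, hδ, hδε⟩ : ∃ δ > 0,
      Fintype.card ι * (4 / θ ^ 2 * (p⁻¹ ^ h * (h * δ))) ≤ ε / 2 := by
    set a : ℝ := Fintype.card ι * (4 / θ ^ 2 * (p⁻¹ ^ h * h)) with ha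
    have ha0 : 0 ≤ a := by positivity
    refine ⟨ε / 2 / (a + 1), by positivity, ?_⟩
    calc _ = a / (a + 1) * (ε / 2) := by rw [ha]; ring
      _ ≤ ε / 2 := mul_le_of_le_one_left (by positivity)
        ((div_le_one (by positivity)).2 (by linarith))
  refine ⟨⌊h / δ⌋₊, c / 2, by positivity, ?_⟩
  intro S _ G H E hmono hcard hE hG
  let T := {q : Finset S × Set (Finset S) // q.1.card ≤ h ∧ Monotone (fun R => R ∈ q.2) ∧
    expect p (fun R => if R ∪ q.1 ∈ q.2 then 0 else 1) ≤ ε * θ / 8}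
  have : Fintype T := Fintype.ofFinite T
  let A : T → Set Cantor := fun t => {x | x ∈ G ∧ H x = t.1.1 ∧ {R | E x R} = t.1.2}
  have hA : ⋃ t, A t = G := by
    ext x
    refine ⟨fun hx => (Set.mem_iUnion.1 hx).elim fun t ht => ht.1, fun hx => ?_⟩
    exact Set.mem_iUnion.2 ⟨⟨(H x, {R | E x R}), hcard x hx, hmono x, hE x hx⟩, hx, rfl, rfl⟩
  obtain ⟨M, hM1, hM⟩ := exists_disjoint_weights cantorMeasure A
  have hmeas : ∀ B : Set (List Bool), MeasurableSet (cylSet B)ᶜ := fun B =>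
    (measurableSet_cylSet B).compl
  rw [le_sqcap_iff] at hG
  obtain ⟨H', hH', hexp⟩ := exists_heavy_set (S := S) (ι := ι) (T := T) (h := h) (θ := θ) (ε := ε)
    hp0 hp1 hθ hδ hδε hM1
    (v := fun i t => cantorMeasure.real (M t ∩ (cylSet i.1)ᶜ)) (fun _ => measureReal_nonneg)
    (fun _ _ => measureReal_nonneg) (fun i t => measureReal_mono Set.inter_subset_left)
    (fun i => by
      refine le_trans ?_ (hM _ (hmeas i.1)).1
      rw [hA, ← Set.sdiff_eq]
      exact (ENNReal.ofReal_le_iff_le_toReal (measure_ne_top _ _)).1 (hG i.1 i.2.2))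
    (H := fun t => t.1.1) (fun t => t.2.1) (E := fun t R => R ∈ t.1.2) (fun t => t.2.2.1)
    (fun t => t.2.2.2)
  refine ⟨H', Nat.le_floor hH', (expect_mono hp0.le hp1 fun R => ?_).trans hexp⟩
  split_ifs with h1 h2 h2
  · exact le_rfl
  · exact zero_le_one
  · refine absurd ?_ h1
    rw [le_sqcap_iff]
    intro B hB
    set B₀ := {a ∈ B | a.length < m}
    set B₁ := {a ∈ B | m ≤ a.length}
    have hBB : B = B₀ ∪ B₁ := by
      ext a
      simp only [B₀, B₁, Set.mem_union, Set.mem_sep_iff, ← and_or_left, lt_or_ge, and_true]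
    have hB₀ : wtSum r B₀ < ENNReal.ofReal γ := (wtSum_mono r (Set.sep_subset _ _)).trans_lt hB
    have hB₁ : cantorMeasure (cylSet B₁) ≤ ENNReal.ofReal (c / 2) := by
      refine (cantorMeasure_cylSet_le hr1 m fun a ha => ha.2).trans (le_trans ?_ hm)
      gcongr
      exact ((wtSum_mono r (Set.sep_subset _ _)).trans_lt hB).le
    set G' := {x | x ∈ G ∧ E x (R ∪ H')}
    have hlow : ENNReal.ofReal c ≤ cantorMeasure (G' \ cylSet B₀) := by
      rw [ENNReal.ofReal_le_iff_le_toReal (measure_ne_top _ _)]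
      refine (h2 ⟨B₀, fun a ha => ha.2, hB₀⟩).trans <|
        ((hM _ (hmeas B₀)).2 fun t => R ∪ H' ∈ t.1.2).trans (measureReal_mono ?_)
      rintro x ⟨hx, hxB⟩
      obtain ⟨t, ht, hxG, -, hxE⟩ := Set.mem_iUnion₂.1 hx
      refine ⟨⟨hxG, ?_⟩, hxB⟩
      rw [← hxE] at ht
      exact ht
    have hsub : G' \ cylSet B₀ ⊆ (G' \ cylSet B) ∪ cylSet B₁ := by
      intro x hx
      by_cases hx1 : x ∈ cylSet B₁
      · exact Or.inr hx1
      · refine Or.inl ⟨hx.1, ?_⟩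
        rw [hBB, cylSet_union]
        exact fun hxB => hxB.elim hx.2 hx1
    have hadd : ENNReal.ofReal (c / 2) + ENNReal.ofReal (c / 2)
        ≤ cantorMeasure (G' \ cylSet B) + ENNReal.ofReal (c / 2) := by
      rw [← ENNReal.ofReal_add (by positivity) (by positivity), add_halves]
      exact hlow.trans ((measure_mono hsub).trans
        ((measure_union_le _ _).trans (add_le_add_right hB₁ _)))
    exact (ENNReal.add_le_add_iff_right ENNReal.ofReal_ne_top).1 hadd
  · exact le_rfl

open Classical in
lemma exists_SqTG_random {r p : ℝ} (hr1 : r < 1) (hp0 : 0 < p) (hp1 : p ≤ 1) {Θ : ℕ → ℝ}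
    (Γ : ℕ → ℝ) (hΘ : ∀ i, 0 < Θ i) (n d : ℕ) {ε : ℝ} (hε : 0 < ε) :
    ∃ h : ℕ, ∃ η : ℕ → ℝ, (∀ i, 0 < η i) ∧ ∀ (S : Type) [Fintype S]
      (C : Set (Fin (d + 1) → Cantor)) (f : (Fin (d + 1) → Cantor) → Finset S),
      (∀ z, (f z).card ≤ n) → SqTG r Θ Γ d C →
      ∃ H : Finset S, H.card ≤ h ∧
        expect p (fun R => if SqTG r η Γ d {z | z ∈ C ∧ f z ⊆ R ∪ H} then 0 else 1) ≤ ε := by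
  induction d generalizing ε with
  | zero =>
    obtain ⟨h, η, hη, H⟩ := exists_le_sqcap (γ := Γ 0) hr1 hp0 hp1 (hΘ 0) hε n
    refine ⟨h, fun _ => η, fun _ => hη, fun S _ C f hf hC => ?_⟩
    obtain ⟨L, hL, hexp⟩ := H S {y | (fun _ => y) ∈ C} (fun y => f fun _ => y)
      (fun y R => f (fun _ => y) ⊆ R)
      (fun y R R' hR => fun hy => hy.trans hR) (fun y _ => hf _) (fun y _ => by
        simp only [Finset.subset_union_right, if_true, expect_const]
        have := hΘ 0
        positivity) hC
    refine ⟨L, hL, ?_⟩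
    convert hexp using 4
    exact Iff.rfl
  | succ d ih =>
    obtain ⟨h, η, hη, H⟩ := ih (ε := ε * Θ (d + 1) / 8) (by have := hΘ (d + 1); positivity)
    obtain ⟨h', η', hη', H'⟩ := exists_le_sqcap (γ := Γ (d + 1)) hr1 hp0 hp1 (hΘ (d + 1)) hε h
    refine ⟨h', Function.update η (d + 1) η', fun i => ?_, fun S _ C f hf hC => ?_⟩
    · rcases eq_or_ne i (d + 1) with rfl | hi
      · simpa using hη'
      · simpa [hi] using hη i
    have hcongr : SqTG r (Function.update η (d + 1) η') Γ d = SqTG r η Γ d :=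
      SqTG_congr fun i hi => Function.update_of_ne (by omega) _ _
    let slice : Cantor → Set (Fin (d + 1) → Cantor) := fun x => {y | Fin.cons x y ∈ C}
    have hsel : ∀ x, ∃ K : Finset S, SqTG r Θ Γ d (slice x) → K.card ≤ h ∧
        expect p (fun R => if SqTG r η Γ d {y | y ∈ slice x ∧ f (Fin.cons x y) ⊆ R ∪ K}
          then 0 else 1) ≤ ε * Θ (d + 1) / 8 := by
      intro x
      by_cases hx : SqTG r Θ Γ d (slice x)
      · obtain ⟨K, hK⟩ := H S (slice x) (fun y => f (Fin.cons x y)) (fun y => hf _) hx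
        exact ⟨K, fun _ => hK⟩
      · exact ⟨∅, fun h => absurd h hx⟩
    choose K hK using hsel
    obtain ⟨L, hL, hexp⟩ := H' S {x | SqTG r Θ Γ d (slice x)} K
      (fun x R => SqTG r η Γ d {y | y ∈ slice x ∧ f (Fin.cons x y) ⊆ R})
      (fun x R R' hR => SqTG_mono r η Γ d fun y hy => ⟨hy.1, hy.2.trans hR⟩)
      (fun x hx => (hK x hx).1) (fun x hx => (hK x hx).2) hC
    refine ⟨L, hL, (expect_mono hp0.le hp1 fun R => ?_).trans hexp⟩
    split_ifs with h1 h2 h2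
    · exact le_rfl
    · exact zero_le_one
    · refine absurd ?_ h1
      simp only [SqTG, hcongr, Function.update_self]
      exact h2.trans (sqcap_mono _ _ fun x hx => hx.2)
    · exact le_rfl

lemma wtSum_one_ofFn_image_le {k : ℕ} (W : Finset (Fin k → Bool)) {c : ℝ}
    (hW : (W.card : ℝ) ≤ c * 2 ^ k) : wtSum 1 (List.ofFn '' (W : Set (Fin k → Bool)))
      ≤ ENNReal.ofReal c := by
  have hinj : Set.InjOn (List.ofFn : (Fin k → Bool) → List Bool) W := List.ofFn_injective.injOn
  have hterm : ∀ s : Fin k → Bool, wt 1 (List.ofFn s) = ENNReal.ofReal ((2 ^ k)⁻¹) := by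
    intro s
    rw [wt, List.length_ofFn, mul_one, ENNReal.rpow_neg, ENNReal.rpow_natCast,
      ENNReal.ofReal_inv_of_pos (by positivity), ENNReal.ofReal_pow (by norm_num),
      ENNReal.ofReal_ofNat]
  rw [wtSum, tsum_image (wt 1) hinj]
  simp only [hterm]
  rw [Finset.tsum_subtype' W fun _ => ENNReal.ofReal ((2 ^ k)⁻¹), Finset.sum_const, nsmul_eq_mul,
    ← ENNReal.ofReal_natCast, ← ENNReal.ofReal_mul (by positivity)]
  refine ENNReal.ofReal_le_ofReal ?_
  rwa [← div_eq_mul_inv, div_le_iff₀ (by positivity)]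

/-- here the ambient dimension is `d + 1 ≥ 1`. -/
theorem statement7 (r : ℝ) (hr0 : 0 < r) (hr1 : r < 1)
    (Θ Γ : ℕ → ℝ) (hΘpos : ∀ i, 0 < Θ i) (hΓpos : ∀ i, 0 < Γ i)
    (hΘΓ : ∀ i, Θ i + Γ i < 1)
    (d : ℕ) (C : Set (Fin (d + 1) → Cantor)) (hCclosed : IsClosed C)
    (hC : SqTG r Θ Γ d C)
    (n : ℕ) (F : Fin n → (Fin (d + 1) → Cantor) → Cantor)
    (hFcont : ∀ j, ContinuousOn (F j) C)
    (μ₀ : ℝ) (hμ : 0 < μ₀) :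
    ∃ a : Set (List Bool), memCinf 1 μ₀ a ∧
      ∃ η : ℕ → ℝ, (∀ i, 0 < η i) ∧
        SqTG r η Γ d (C ∩ ⋂ j : Fin n, F j ⁻¹' cylSet a) := by
  classical
  set p := min (μ₀ / 8) 1
  have hp0 : 0 < p := lt_min (by positivity) one_pos
  have hp1 : p ≤ 1 := min_le_right _ _
  obtain ⟨h, η, hη, key⟩ := exists_SqTG_random (r := r) hr1 hp0 hp1 Γ hΘpos n d
    (by norm_num : (0 : ℝ) < 1 / 4)
  obtain ⟨k, hk⟩ : ∃ k : ℕ, 2 * h / μ₀ < 2 ^ k := pow_unbounded_of_one_lt _ one_lt_two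
  rw [div_lt_iff₀ hμ] at hk
  let S := Fin k → Bool
  obtain ⟨H, hH, hexp⟩ := key S C (fun z => Finset.univ.image fun j (i : Fin k) => F j z i)
    (fun z => Finset.card_image_le.trans (by simp)) hC
  have hmean : expect p (fun R : Finset S => (R.card : ℝ)) = p * 2 ^ k := by
    have e : (fun R : Finset S => (R.card : ℝ)) = fun R => ∑ s, if {s} ⊆ R then (1 : ℝ) else 0 := by
      ext R
      simp
    rw [e, expect_sum]
    simp only [expect_ite_subset, expect_const, Finset.card_singleton, pow_one, mul_one]
    simp [S, mul_comm]
  have hpos : 0 < μ₀ / 2 * 2 ^ k := by positivity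
  obtain ⟨R, hR, hRcard⟩ : ∃ R : Finset S, SqTG r η Γ d
      {z | z ∈ C ∧ (Finset.univ.image fun j (i : Fin k) => F j z i) ⊆ R ∪ H} ∧
      (R.card : ℝ) ≤ μ₀ / 2 * 2 ^ k := by
    by_contra! hcon
    have hle := expect_mono hp0.le hp1 (S := S) (φ := fun _ => 1)
      (ψ := fun R => (if SqTG r η Γ d
        {z | z ∈ C ∧ (Finset.univ.image fun j (i : Fin k) => F j z i) ⊆ R ∪ H} then 0 else 1)
          + (μ₀ / 2 * 2 ^ k)⁻¹ * R.card) fun R => by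
        have h0 : (0 : ℝ) ≤ (μ₀ / 2 * 2 ^ k)⁻¹ * R.card := by positivity
        split_ifs with h1
        · rw [zero_add, ← div_eq_inv_mul, one_le_div hpos]
          exact (hcon R h1).le
        · linarith
    rw [expect_const, expect_add, expect_const_mul, hmean] at hle
    have hsmall : (μ₀ / 2 * 2 ^ k)⁻¹ * (p * 2 ^ k) ≤ 1 / 4 := by
      rw [inv_mul_le_iff₀ hpos]
      have : p ≤ μ₀ / 8 := min_le_left _ _
      calc p * 2 ^ k ≤ μ₀ / 8 * 2 ^ k := by gcongr
        _ = _ := by ring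
    have hexp' : expect p (fun R : Finset S => if SqTG r η Γ d
        {z | z ∈ C ∧ (Finset.univ.image fun j (i : Fin k) => F j z i) ⊆ R ∪ H}
          then (0 : ℝ) else 1) ≤ 1 / 4 := by convert hexp
    linarith
  refine ⟨List.ofFn '' ((R ∪ H : Finset S) : Set S), wtSum_one_ofFn_image_le _ ?_, η, hη, ?_⟩
  · have h1 : ((R ∪ H).card : ℝ) ≤ R.card + H.card := by exact_mod_cast Finset.card_union_le R H
    have h2 : (H.card : ℝ) ≤ h := by exact_mod_cast hH
    linarith
  · refine SqTG_mono r η Γ d (fun z hz => ⟨hz.1, Set.mem_iInter.2 fun j => ?_⟩) hR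
    have hmem := hz.2 (Finset.mem_image_of_mem _ (Finset.mem_univ j))
    refine Set.mem_iUnion₂.2 ⟨_, Set.mem_image_of_mem _ (Finset.mem_coe.2 hmem), fun i => ?_⟩
    simp
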